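/- arXiv:2205.04254 — 2 statements merged into one kernel-verified Lean document; each statement's English description precedes it below -/
import Mathlib

section
/- Let f ∈ ℝ[x] and let f* := inf{f(x) : x ∈ S(g)}. Assume f attains a global minimizer on S(g) and that g is one of the following tuples: (1) g = (1 − x_1² − … − x_n²) (the unit ball); (2) g = (1 − x_1², …, 1 − x_n²) (the unit hypercube); (3) g = (x_1, …, x_n, 1 − x_1 − … − x_n) (the unit simplex). Then there exists k ∈ ℕ such that ρ_k(f, g, h_FJ) = f*. -/
open MvPolynomial

noncomputable section

/-- `p` is a sum of squares of polynomials. -/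
def IsSOS {σ : Type*} (p : MvPolynomial σ ℝ) : Prop :=
  ∃ (k : ℕ) (q : Fin k → MvPolynomial σ ℝ), p = ∑ i, q i ^ 2

/-- Membership in the truncated quadratic module `Q_k(g)` of order `k`. -/
def InTruncQM {σ ι : Type*} [Fintype ι] (k : ℕ) (g : ι → MvPolynomial σ ℝ)
    (p : MvPolynomial σ ℝ) : Prop :=
  ∃ (s0 : MvPolynomial σ ℝ) (s : ι → MvPolynomial σ ℝ),
    IsSOS s0 ∧ (∀ j, IsSOS (s j)) ∧ s0.totalDegree ≤ 2 * k ∧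
    (∀ j, (s j * g j).totalDegree ≤ 2 * k) ∧ p = s0 + ∑ j, s j * g j

/-- Membership in the truncated ideal `I_k(h)` of order `k`. -/
def InTruncId {σ ι : Type*} [Fintype ι] (k : ℕ) (h : ι → MvPolynomial σ ℝ)
    (p : MvPolynomial σ ℝ) : Prop :=
  ∃ ps : ι → MvPolynomial σ ℝ, (∀ t, (ps t * h t).totalDegree ≤ 2 * k) ∧ p = ∑ t, ps t * h t

/-- The value `ρ_k(f, g, h)` of the SOS relaxation of order `k`. -/
def rho {σ ι κ : Type*} [Fintype ι] [Fintype κ] (k : ℕ) (f : MvPolynomial σ ℝ)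
    (g : ι → MvPolynomial σ ℝ) (h : κ → MvPolynomial σ ℝ) : ℝ :=
  sSup {ξ : ℝ | ∃ q1 q2, InTruncQM k g q1 ∧ InTruncId k h q2 ∧ f - C ξ = q1 + q2}

/-- The basic semi-algebraic set `S(g)`. -/
def Sg {n m : ℕ} (g : Fin m → MvPolynomial (Fin n) ℝ) : Set (Fin n → ℝ) :=
  {x | ∀ j, 0 ≤ eval x (g j)}

/-- The Fritz John polynomial system `h_FJ`, a tuple of `n + m + 1` polynomials in
`ℝ[x, λ̄]`. -/
def hFJ {n m : ℕ} (f : MvPolynomial (Fin n) ℝ) (g : Fin m → MvPolynomial (Fin n) ℝ) :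
    Fin n ⊕ (Fin m ⊕ Unit) → MvPolynomial (Fin n ⊕ Fin (m + 1)) ℝ
  | Sum.inl i => X (Sum.inr 0) * rename Sum.inl (pderiv i f)
      - ∑ j : Fin m, X (Sum.inr j.succ) * rename Sum.inl (pderiv i (g j))
  | Sum.inr (Sum.inl j) => X (Sum.inr j.succ) * rename Sum.inl (g j)
  | Sum.inr (Sum.inr _) => 1 - ∑ j : Fin (m + 1), X (Sum.inr j) ^ 2

/-- The constraints describing the unit ball. -/
def ballG (n : ℕ) : Fin 1 → MvPolynomial (Fin n) ℝ :=
  fun _ => C 1 - ∑ i : Fin n, X i ^ 2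

/-- The constraints describing the unit hypercube. -/
def boxG (n : ℕ) : Fin n → MvPolynomial (Fin n) ℝ :=
  fun i => C 1 - X i ^ 2

/-- The constraints describing the unit simplex. -/
def simplexG (n : ℕ) : Fin (n + 1) → MvPolynomial (Fin n) ℝ :=
  Fin.snoc (fun i => X i) (C 1 - ∑ i : Fin n, X i)


/-- A transcendental element of an essentially finitely generated field extension in
characteristic zero has nonzero differential. -/
theorem KaehlerDifferential.D_ne_zero_of_transcendental {k K : Type} [Field k] [CharZero k]
    [Field K] [Algebra k K] [Algebra.EssFiniteType k K] {F : K} (hF : Transcendental k F) :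
    KaehlerDifferential.D k K F ≠ 0 := by
  let : Algebra (Polynomial k) K := (Polynomial.aeval F).toAlgebra
  have hmap : ∀ p : Polynomial k, algebraMap (Polynomial k) K p = Polynomial.aeval F p :=
    fun _ => rfl
  have : IsScalarTower k (Polynomial k) K :=
    IsScalarTower.of_algebraMap_eq fun r => by simp [hmap]
  have : FaithfulSMul (Polynomial k) K := by
    rw [faithfulSMul_iff_algebraMap_injective]
    exact transcendental_iff_injective.mp hF
  let : Algebra (FractionRing (Polynomial k)) K := FractionRing.liftAlgebra (Polynomial k) K
  have : IsScalarTower (Polynomial k) (FractionRing (Polynomial k)) K :=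
    FractionRing.isScalarTower_liftAlgebra (Polynomial k) K
  have : IsScalarTower k (FractionRing (Polynomial k)) K := .to₁₃₄ k (Polynomial k) _ _
  have : Algebra.EssFiniteType (FractionRing (Polynomial k)) K := .of_comp k _ _
  have : CharZero (FractionRing (Polynomial k)) :=
    charZero_of_injective_algebraMap (R := k) (algebraMap k _).injective
  have : Algebra.FormallySmooth (Polynomial k) (FractionRing (Polynomial k)) :=
    .of_isLocalization (nonZeroDivisors _)
  have : Algebra.FormallySmooth (Polynomial k) K := .comp _ (FractionRing (Polynomial k)) _
  have hinj : Function.Injective (KaehlerDifferential.mapBaseChange k (Polynomial k) K) := by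
    rw [injective_iff_map_eq_zero]
    intro x hx
    obtain ⟨y, rfl⟩ := (Algebra.H1Cotangent.exact_δ_mapBaseChange k (Polynomial k) K x).mp hx
    rw [Subsingleton.elim y 0, map_zero]
  intro h0
  have h1 : TensorProduct.tmul (Polynomial k) (1 : K)
      (KaehlerDifferential.D k (Polynomial k) Polynomial.X) = 0 := by
    apply hinj
    rw [map_zero, KaehlerDifferential.mapBaseChange_tmul, KaehlerDifferential.map_D, hmap,
      Polynomial.aeval_X, h0, smul_zero]
  have h2 := congrArg (TensorProduct.rid (Polynomial k) K) (congrArg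
    (LinearMap.lTensor K (KaehlerDifferential.polynomialEquiv k).toLinearMap) h1)
  simp at h2

/-- If `F` has zero differential at every point of `V(I)`, then `F` is algebraic modulo `I`. -/
theorem exists_aeval_mem_of_D_eq_zero {k R : Type} [Field k] [CharZero k] [CommRing R]
    [Algebra k R] [Algebra.FiniteType k R] (I : Ideal R) (F : R)
    (h : ∀ (K : Type) [Field K] [Algebra k K] (φ : R →ₐ[k] K), (∀ a ∈ I, φ a = 0) →
      KaehlerDifferential.D k K (φ F) = 0) :
    ∃ p : Polynomial k, p ≠ 0 ∧ Polynomial.aeval F p ∈ I := by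
  by_contra! hcon
  let S : Submonoid R := (nonZeroDivisors (Polynomial k)).map (Polynomial.aeval F)
  have hS : Disjoint (I : Set R) S := by
    rw [Set.disjoint_left]
    rintro _ ha ⟨p, hp, rfl⟩
    exact hcon p (nonZeroDivisors.ne_zero hp) ha
  obtain ⟨P, hP, hIP, hPS⟩ := Ideal.exists_le_prime_disjoint I S hS
  let φ : R →ₐ[k] FractionRing (R ⧸ P) :=
    (IsScalarTower.toAlgHom k (R ⧸ P) (FractionRing (R ⧸ P))).comp (Ideal.Quotient.mkₐ k P)
  have hφ : ∀ a, φ a = 0 ↔ a ∈ P := fun a => by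
    simp [φ, Ideal.Quotient.eq_zero_iff_mem]
  refine KaehlerDifferential.D_ne_zero_of_transcendental (k := k) (F := φ F) ?_
    (h _ φ fun a ha => (hφ a).mpr (hIP ha))
  rw [transcendental_iff]
  intro p hp
  by_contra hp0
  rw [Polynomial.aeval_algHom_apply, hφ] at hp
  exact Set.disjoint_left.mp hPS hp ⟨p, mem_nonZeroDivisors_of_ne_zero hp0, rfl⟩

theorem Derivation.apply_aeval {k A M σ : Type*} [Fintype σ] [CommRing k] [CommRing A]
    [Algebra k A] [AddCommGroup M] [Module A M] [Module k M] [IsScalarTower k A M]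
    (D : Derivation k A M) (x : σ → A) (f : MvPolynomial σ k) :
    D (aeval x f) = ∑ i, aeval x (pderiv i f) • D (x i) := by
  classical
  induction f using MvPolynomial.induction_on with
  | C a => simp
  | add p q hp hq => simp [hp, hq, add_smul, Finset.sum_add_distrib]
  | mul_X p i hp =>
    have key : ∀ j, aeval x (pderiv j (p * X i)) • D (x j) =
        (if j = i then aeval x p • D (x i) else 0) + x i • aeval x (pderiv j p) • D (x j) := by
      intro j
      rw [Derivation.leibniz, pderiv_X, Pi.single_apply]
      split_ifs with h h' h'
      · subst h; simp [add_smul, mul_smul]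
      · exact absurd h.symm h'
      · exact absurd h'.symm h
      · simp [mul_smul]
    rw [map_mul, aeval_X, D.leibniz, hp]
    simp only [key, Finset.sum_add_distrib, Finset.sum_ite_eq',
      Finset.mem_univ, if_true, Finset.smul_sum]

/-- The active gradients of `g` are linearly independent at every point over every field
extension of `ℝ`. -/
def Nonsingular {n m : ℕ} (g : Fin m → MvPolynomial (Fin n) ℝ) : Prop :=
  ∀ (K : Type) [Field K] [Algebra ℝ K] (x : Fin n → K) (l : Fin m → K),
    (∀ i, ∑ j, l j * aeval x (pderiv i (g j)) = 0) → (∀ j, l j * aeval x (g j) = 0) →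
      ∀ j, l j = 0

theorem exists_aeval_mem_span_hFJ {n m : ℕ} {g : Fin m → MvPolynomial (Fin n) ℝ}
    (hg : Nonsingular g) (f : MvPolynomial (Fin n) ℝ) :
    ∃ p : Polynomial ℝ, p ≠ 0 ∧
      Polynomial.aeval (rename Sum.inl f : MvPolynomial (Fin n ⊕ Fin (m + 1)) ℝ) p ∈
        Ideal.span (Set.range (hFJ f g)) := by
  refine exists_aeval_mem_of_D_eq_zero _ _ fun K _ _ φ hφ => ?_
  replace hφ : ∀ t, φ (hFJ f g t) = 0 := fun t => hφ _ (Ideal.subset_span ⟨t, rfl⟩)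
  set x : Fin n → K := fun i => φ (X (Sum.inl i))
  set l : Fin (m + 1) → K := fun j => φ (X (Sum.inr j))
  have hren : ∀ q : MvPolynomial (Fin n) ℝ, φ (rename Sum.inl q) = aeval x q := 
    DFunLike.congr_fun (show φ.comp (rename Sum.inl) = aeval x by ext i; simp [x])
  have hgrad : ∀ i, l 0 * aeval x (pderiv i f) =
      ∑ j, l j.succ * aeval x (pderiv i (g j)) := fun i => by
    simpa [hFJ, hren, sub_eq_zero] using hφ (Sum.inl i)
  have hcomp : ∀ j, l j.succ * aeval x (g j) = 0 := fun j => by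
    simpa [hFJ, hren] using hφ (Sum.inr (Sum.inl j))
  have hnorm : 1 - ∑ j, l j ^ 2 = 0 := by
    simpa [hFJ] using hφ (Sum.inr (Sum.inr ()))
  have hl0 : l 0 ≠ 0 := fun h0 => by
    have hz := hg K x (fun j => l j.succ) (fun i => by rw [← hgrad, h0, zero_mul]) hcomp
    simp [Fin.sum_univ_succ, h0, hz] at hnorm
  set D := KaehlerDifferential.D ℝ K
  have hD : l 0 • D (aeval x f) = 0 := by
    have key : l 0 • D (aeval x f) = ∑ j, l j.succ • D (aeval x (g j)) := by
      simp only [Derivation.apply_aeval D, Finset.smul_sum, smul_smul, hgrad, Finset.sum_smul]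
      exact Finset.sum_comm
    rw [key]
    refine Finset.sum_eq_zero fun j _ => ?_
    rcases mul_eq_zero.mp (hcomp j) with h | h <;> simp [h]
  rw [hren]
  exact (smul_eq_zero.mp hD).resolve_left hl0

/-- A univariate real polynomial that is nonnegative on `ℝ` is a sum of squares of polynomials of
at most half its degree. -/
theorem Polynomial.exists_sum_sq_of_nonneg (d : ℕ) (p : Polynomial ℝ)
    (hd : p.natDegree ≤ 2 * d) (hp : ∀ x, 0 ≤ p.eval x) :
    ∃ (k : ℕ) (q : Fin k → Polynomial ℝ), (∀ i, (q i).natDegree ≤ d) ∧ p = ∑ i, q i ^ 2 := by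
  induction d generalizing p with
  | zero =>
    obtain ⟨c, rfl⟩ := Polynomial.natDegree_eq_zero.mp (by omega : p.natDegree = 0)
    have hc : 0 ≤ c := by simpa using hp 0
    exact ⟨1, fun _ => Polynomial.C √c, fun _ => by simp, by
      simp [← Polynomial.C_pow, Real.sq_sqrt hc]⟩
  | succ d ih =>
    by_cases h0 : p.natDegree = 0
    · obtain ⟨k, q, hq, h⟩ := ih p (by omega) hp
      exact ⟨k, q, fun i => (hq i).trans d.le_succ, h⟩
    have hdeg : 0 < p.degree := Polynomial.natDegree_pos_iff_degree_pos.mp (by omega)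
    obtain ⟨r, hr⟩ := p.continuous.exists_forall_le (by
      simpa [abs_of_nonneg (hp _)] using
        p.tendsto_norm_atTop (l := Filter.cocompact ℝ) (z := id) hdeg tendsto_norm_cocompact_atTop)
    set m := p.eval r with hm
    have hm0 : 0 ≤ m := hp r
    obtain ⟨a, ha⟩ : Polynomial.X - Polynomial.C r ∣ p - Polynomial.C m := by
      rw [Polynomial.dvd_iff_isRoot]; simp [hm]
    have hmin : IsLocalMin (fun x => p.eval x) r := Filter.Eventually.of_forall hr
    have hder : p.derivative.eval r = 0 := by
      rw [← Polynomial.deriv]; exact hmin.deriv_eq_zero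
    have har : a.eval r = 0 := by
      have := congrArg (fun q => (Polynomial.derivative q).eval r) ha
      simpa [hder] using this.symm
    obtain ⟨b, rfl⟩ : Polynomial.X - Polynomial.C r ∣ a := by
      rwa [Polynomial.dvd_iff_isRoot]
    have hpb : p = (Polynomial.X - Polynomial.C r) ^ 2 * b + Polynomial.C m := by
      rw [← sub_eq_iff_eq_add, ha]; ring
    have hbpos : ∀ x, 0 ≤ b.eval x := by
      have hne : ∀ x, x ≠ r → 0 ≤ b.eval x := fun x hx => by
        have h1 : m ≤ p.eval x := hr x
        have h2 : p.eval x = (x - r) ^ 2 * b.eval x + m := by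
          conv_lhs => rw [hpb]
          simp
        have h3 : 0 < (x - r) ^ 2 := by have := sub_ne_zero.mpr hx; positivity
        exact nonneg_of_mul_nonneg_right (by linarith : 0 ≤ (x - r) ^ 2 * b.eval x) h3
      have hcl : IsClosed {x | 0 ≤ b.eval x} := isClosed_le continuous_const b.continuous
      have hdense : Dense ({r}ᶜ : Set ℝ) := dense_compl_singleton r
      exact fun x => (hcl.closure_subset_iff.mpr hne) (hdense x)
    have hbdeg : b.natDegree ≤ 2 * d := by
      by_cases hb : b = 0
      · simp [hb]
      have h1 : ((Polynomial.X - Polynomial.C r) ^ 2 * b).natDegree = 2 + b.natDegree := by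
        rw [((Polynomial.monic_X_sub_C r).pow 2).natDegree_mul' hb]
        simp [Polynomial.natDegree_pow]
      rw [hpb, Polynomial.natDegree_add_C, h1] at hd
      omega
    obtain ⟨k, q, hq, hsum⟩ := ih b hbdeg hbpos
    refine ⟨k + 1, Fin.cons (Polynomial.C √m) fun i => (Polynomial.X - Polynomial.C r) * q i,
      fun i => ?_, ?_⟩
    · refine Fin.cases (by simp) (fun i => ?_) i
      simp only [Fin.cons_succ]
      refine Polynomial.natDegree_mul_le.trans ?_
      have := hq i
      rw [Polynomial.natDegree_X_sub_C]
      omega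
    · rw [Fin.sum_univ_succ]
      simp only [Fin.cons_zero, Fin.cons_succ, mul_pow, ← Finset.mul_sum, ← hsum,
        ← Polynomial.C_pow, Real.sq_sqrt hm0]
      rw [add_comm, ← hpb]

theorem Polynomial.exists_forall_eval_add_nonneg {p q : Polynomial ℝ}
    (hdeg : q.degree < (p ^ 2).degree) (hpos : ∀ x, p.eval x = 0 → 0 < q.eval x) :
    ∃ N : ℝ, ∀ x, 0 ≤ (q + Polynomial.C N * p ^ 2).eval x := by
  have hev : ∀ᶠ x in Filter.cocompact ℝ, |q.eval x| ≤ (p ^ 2).eval x := by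
    have hp0 : p ^ 2 ≠ 0 := by rintro h; simp [h] at hdeg
    have hle : ∀ l : Filter ℝ, (∀ᶠ x in l, ¬ (p ^ 2).IsRoot x) →
        Filter.Tendsto (fun x => q.eval x / (p ^ 2).eval x) l (nhds 0) →
        ∀ᶠ x in l, |q.eval x| ≤ (p ^ 2).eval x := by
      intro l hroot hlim
      filter_upwards [hlim.eventually (Metric.ball_mem_nhds 0 one_pos), hroot] with x hx hx0
      have hpos : 0 < (p ^ 2).eval x := by
        rw [Polynomial.IsRoot] at hx0
        rw [Polynomial.eval_pow] at *
        positivity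
      rw [dist_zero_right, Real.norm_eq_abs, abs_div, abs_of_pos hpos, div_lt_one hpos] at hx
      exact hx.le
    rw [cocompact_eq_atBot_atTop, Filter.eventually_sup]
    exact ⟨hle _ (Polynomial.eventually_atBot_not_isRoot _ hp0)
        (Polynomial.div_tendsto_atBot_zero_of_degree_lt q _ hdeg),
      hle _ (Polynomial.eventually_atTop_not_isRoot _ hp0)
        (Polynomial.div_tendsto_atTop_zero_of_degree_lt q _ hdeg)⟩
  obtain ⟨K, hK, hKe⟩ := Filter.mem_cocompact.mp hev
  have hT : IsCompact (K ∩ {x | q.eval x ≤ 0}) :=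
    hK.inter_right (isClosed_le q.continuous continuous_const)
  have hcont : ContinuousOn (fun x => -q.eval x / (p ^ 2).eval x) (K ∩ {x | q.eval x ≤ 0}) := by
    refine q.continuous.neg.continuousOn.div (p ^ 2).continuous.continuousOn fun x hx h0 => ?_
    have := hpos x (by simpa using h0)
    exact absurd hx.2 (not_le.mpr this)
  obtain ⟨N, hN⟩ := (hT.image_of_continuousOn hcont).bddAbove
  refine ⟨max N 1, fun x => ?_⟩
  have hsq : 0 ≤ (p ^ 2).eval x := by rw [Polynomial.eval_pow]; positivity
  rw [Polynomial.eval_add, Polynomial.eval_mul, Polynomial.eval_C]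
  rcases lt_or_ge 0 (q.eval x) with hq | hq
  · positivity
  by_cases hx : x ∈ K
  · have h := hN ⟨x, ⟨hx, hq⟩, rfl⟩
    have hpne : (p ^ 2).eval x ≠ 0 := fun h0 => absurd hq (not_le.mpr (hpos x (by simpa using h0)))
    have hpp : 0 < (p ^ 2).eval x := lt_of_le_of_ne hsq hpne.symm
    rw [div_le_iff₀ hpp] at h
    nlinarith [le_max_left N 1]
  · have h : |q.eval x| ≤ (p ^ 2).eval x := hKe hx
    nlinarith [le_max_right N 1, neg_abs_le (q.eval x)]

/-- A quadratic module of a commutative ring: it contains the squares and is stable under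
addition and multiplication by squares. -/
structure IsQuadraticModule {A : Type*} [CommRing A] (M : Set A) : Prop where
  one_mem : 1 ∈ M
  add_mem : ∀ {a b}, a ∈ M → b ∈ M → a + b ∈ M
  sq_mul_mem : ∀ (c : A) {a}, a ∈ M → c ^ 2 * a ∈ M

namespace IsQuadraticModule

section CommRing

variable {A : Type*} [CommRing A] {M : Set A}

theorem sq_mem (hM : IsQuadraticModule M) (c : A) : c ^ 2 ∈ M := by
  simpa using hM.sq_mul_mem c hM.one_mem

theorem zero_mem (hM : IsQuadraticModule M) : 0 ∈ M := by
  simpa using hM.sq_mem 0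

theorem sum_mem (hM : IsQuadraticModule M) {ι : Type*} (s : Finset ι) {a : ι → A}
    (ha : ∀ i ∈ s, a i ∈ M) : ∑ i ∈ s, a i ∈ M := by
  classical
  induction s using Finset.induction_on with
  | empty => simpa using hM.zero_mem
  | insert i s hi ih =>
    rw [Finset.sum_insert hi]
    exact hM.add_mem (ha _ (by simp)) (ih fun j hj => ha j (by simp [hj]))

theorem sumSq_mul_mem (hM : IsQuadraticModule M) {s : A} (hs : IsSumSq s) {a : A} (ha : a ∈ M) :
    s * a ∈ M := by
  induction hs with
  | zero => simpa using hM.zero_mem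
  | sq_add c _ ih =>
    rw [add_mul, ← pow_two]
    exact hM.add_mem (hM.sq_mul_mem c ha) ih

theorem sumSq_mem (hM : IsQuadraticModule M) {s : A} (hs : IsSumSq s) : s ∈ M := by
  simpa using hM.sumSq_mul_mem hs hM.one_mem

/-- The quadratic module generated by `M` and `a`. -/
theorem adjoin (hM : IsQuadraticModule M) (a : A) :
    IsQuadraticModule {b | ∃ m ∈ M, ∃ s, IsSumSq s ∧ b = m + s * a} where
  one_mem := ⟨1, hM.one_mem, 0, .zero, by simp⟩
  add_mem := by
    rintro _ _ ⟨m, hm, s, hs, rfl⟩ ⟨m', hm', s', hs', rfl⟩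
    exact ⟨m + m', hM.add_mem hm hm', s + s', hs.add hs', by ring⟩
  sq_mul_mem := by
    rintro c _ ⟨m, hm, s, hs, rfl⟩
    exact ⟨c ^ 2 * m, hM.sq_mul_mem c hm, c ^ 2 * s,
      (IsSquare.isSumSq ⟨c, pow_two c⟩).mul hs, by ring⟩

/-- A proper quadratic module is contained in a maximal one. -/
theorem exists_maximal (hM : IsQuadraticModule M) (h1 : -1 ∉ M) :
    ∃ N, M ⊆ N ∧ Maximal (fun N : Set A => IsQuadraticModule N ∧ -1 ∉ N) N := by
  refine zorn_subset_nonempty {N | IsQuadraticModule N ∧ -1 ∉ N} ?_ M ⟨hM, h1⟩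
  rintro c hc hchain ⟨N₀, hN₀⟩
  refine ⟨⋃₀ c, ⟨⟨?_, ?_, ?_⟩, ?_⟩, fun N hN => Set.subset_sUnion_of_mem hN⟩
  · exact ⟨N₀, hN₀, (hc hN₀).1.one_mem⟩
  · rintro a b ⟨N, hN, ha⟩ ⟨N', hN', hb⟩
    rcases hchain.total hN hN' with h | h
    · exact ⟨N', hN', (hc hN').1.add_mem (h ha) hb⟩
    · exact ⟨N, hN, (hc hN).1.add_mem ha (h hb)⟩
  · rintro d a ⟨N, hN, ha⟩
    exact ⟨N, hN, (hc hN).1.sq_mul_mem d ha⟩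
  · rintro ⟨N, hN, h⟩
    exact (hc hN).2 h

end CommRing

section Real

variable {A : Type*} [CommRing A] [Algebra ℝ A] {M : Set A}

theorem smul_mem (hM : IsQuadraticModule M) {r : ℝ} (hr : 0 ≤ r) {a : A} (ha : a ∈ M) :
    r • a ∈ M := by
  have := hM.sq_mul_mem (algebraMap ℝ A √r) ha
  rwa [← map_pow, Real.sq_sqrt hr, ← Algebra.smul_def] at this

theorem algebraMap_mem (hM : IsQuadraticModule M) {r : ℝ} (hr : 0 ≤ r) : algebraMap ℝ A r ∈ M := by
  simpa [Algebra.algebraMap_eq_smul_one] using hM.smul_mem hr hM.one_mem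

theorem nonneg_of_algebraMap_mem (hM : IsQuadraticModule M) (h1 : -1 ∉ M) {r : ℝ}
    (h : algebraMap ℝ A r ∈ M) : 0 ≤ r := by
  by_contra! hr
  apply h1
  have := hM.smul_mem (r := (-r)⁻¹) (by rw [inv_nonneg]; linarith) h
  rwa [Algebra.smul_def, ← map_mul, inv_neg, neg_mul, inv_mul_cancel₀ hr.ne, map_neg,
    map_one] at this

theorem mul_mem_of_neg_mem (hM : IsQuadraticModule M) {a : A} (ha : a ∈ M) (ha' : -a ∈ M) (b : A) :
    b * a ∈ M := by
  set c := algebraMap ℝ A 2⁻¹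
  have hc : c * 2 = 1 := by
    rw [← map_ofNat (algebraMap ℝ A) 2, ← map_mul]; norm_num
  have hb : b * a = (c * (b + 1)) ^ 2 * a + (c * (b - 1)) ^ 2 * -a := by
    linear_combination (-(c * 2 + 1) * b * a) * hc
  rw [hb]
  exact hM.add_mem (hM.sq_mul_mem _ ha) (hM.sq_mul_mem _ ha')

/-- A maximal proper quadratic module contains every element or its opposite. -/
theorem mem_or_neg_mem (hM : Maximal (fun N : Set A => IsQuadraticModule N ∧ -1 ∉ N) M) (a : A) :
    a ∈ M ∨ -a ∈ M := by
  have hQ := hM.prop.1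
  have key : ∀ b, b ∉ M → ∃ m ∈ M, ∃ s, IsSumSq s ∧ -1 = m + s * b := by
    intro b hb
    by_contra hcon
    exact hb (hM.2 ⟨hQ.adjoin b, hcon⟩ (fun m hm => ⟨m, hm, 0, .zero, by simp⟩)
      ⟨0, hQ.zero_mem, 1, IsSquare.isSumSq ⟨1, by simp⟩, by simp⟩)
  by_contra! h
  obtain ⟨m, hm, s, hs, e⟩ := key _ h.1
  obtain ⟨m', hm', s', hs', e'⟩ := key _ h.2
  have hneg : -s ∈ M := by
    have : -s = s * m' + s' + s' * m := by linear_combination s' * e + s * e'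
    rw [this]
    exact hQ.add_mem (hQ.add_mem (hQ.sumSq_mul_mem hs hm') (hQ.sumSq_mem hs'))
      (hQ.sumSq_mul_mem hs' hm)
  apply hM.prop.2
  rw [e, mul_comm]
  exact hQ.add_mem hm (hQ.mul_mem_of_neg_mem (hQ.sumSq_mem hs) hneg a)

/-- If `a ^ 2` is bounded above with respect to `M`, so is `a`. -/
theorem exists_bound_of_sq {a : A} {N : ℝ} (hM : IsQuadraticModule M)
    (h : algebraMap ℝ A N - a ^ 2 ∈ M) : algebraMap ℝ A (N + 4⁻¹) - a ∈ M := by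
  set c := algebraMap ℝ A 2⁻¹
  have hc : c * 2 = 1 := by
    rw [← map_ofNat (algebraMap ℝ A) 2, ← map_mul]; norm_num
  have h4 : algebraMap ℝ A 4⁻¹ = c ^ 2 := by rw [← map_pow]; norm_num
  have : algebraMap ℝ A (N + 4⁻¹) - a = (algebraMap ℝ A N - a ^ 2) + (a - c) ^ 2 := by
    rw [map_add, h4]; linear_combination a * hc
  rw [this]
  exact hM.add_mem h (hM.sq_mem _)

end Real

/-- The elements bounded with respect to an archimedean quadratic module exhaust the ring. -/
theorem exists_bound {σ : Type*} {M : Set (MvPolynomial σ ℝ)} (hM : IsQuadraticModule M)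
    (hX : ∀ i, ∃ N : ℝ, C N - X i ^ 2 ∈ M) (a : MvPolynomial σ ℝ) :
    ∃ N : ℝ, 0 ≤ N ∧ C N - a ^ 2 ∈ M := by
  have hC : ∀ {r : ℝ}, 0 ≤ r → C r ∈ M := fun hr => hM.algebraMap_mem hr
  have hmul : ∀ {r : ℝ} {p : MvPolynomial σ ℝ}, 0 ≤ r → p ∈ M → C r * p ∈ M := fun hr hp => by
    rw [← smul_eq_C_mul]; exact hM.smul_mem hr hp
  induction a using MvPolynomial.induction_on with
  | C r => exact ⟨r ^ 2, sq_nonneg r, by simpa using hM.zero_mem⟩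
  | add p q hp hq =>
    obtain ⟨N, hN, h⟩ := hp
    obtain ⟨N', hN', h'⟩ := hq
    refine ⟨2 * N + 2 * N', by positivity, ?_⟩
    have e : C (2 * N + 2 * N') - (p + q) ^ 2 =
        C 2 * (C N - p ^ 2) + C 2 * (C N' - q ^ 2) + (p - q) ^ 2 := by
      simp only [map_add, map_mul]
      rw [show (C 2 : MvPolynomial σ ℝ) = 2 from map_ofNat C 2]
      ring
    rw [e]
    exact hM.add_mem (hM.add_mem (hmul zero_le_two h) (hmul zero_le_two h')) (hM.sq_mem _)
  | mul_X p i hp =>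
    obtain ⟨N, hN, h⟩ := hp
    obtain ⟨N', h'⟩ := hX i
    have h'' : C (max N' 0) - X i ^ 2 ∈ M := by
      have e : (C (max N' 0) - X i ^ 2 : MvPolynomial σ ℝ) =
          C (max N' 0 - N') + (C N' - X i ^ 2) := by rw [C_sub]; ring
      rw [e]
      exact hM.add_mem (hC (by simp)) h'
    refine ⟨N * max N' 0, by positivity, ?_⟩
    have e : (C (N * max N' 0) - (p * X i) ^ 2 : MvPolynomial σ ℝ) =
        C N * (C (max N' 0) - X i ^ 2) + X i ^ 2 * (C N - p ^ 2) := by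
      rw [C_mul]; ring
    rw [e]
    exact hM.add_mem (hmul hN h'') (hM.sq_mul_mem _ h)

/-- An archimedean quadratic module of real polynomials that is nonnegative at no point
contains `-1`. -/
theorem neg_one_mem {σ : Type*} {M : Set (MvPolynomial σ ℝ)} (hM : IsQuadraticModule M)
    (hX : ∀ i, ∃ N : ℝ, C N - X i ^ 2 ∈ M)
    (hpt : ∀ x : σ → ℝ, ∃ p ∈ M, eval x p < 0) : -1 ∈ M := by
  by_contra h1
  obtain ⟨Q, hMQ, hmax⟩ := hM.exists_maximal h1
  obtain ⟨hQ, hQ1⟩ := hmax.prop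
  replace hX : ∀ i, ∃ N : ℝ, C N - X i ^ 2 ∈ Q := fun i => (hX i).imp fun _ h => hMQ h
  have hpos : ∀ {r : ℝ}, C r ∈ Q → 0 ≤ r := fun h => hQ.nonneg_of_algebraMap_mem hQ1 h
  have hC : ∀ {r : ℝ}, 0 ≤ r → C r ∈ Q := fun hr => hQ.algebraMap_mem hr
  have hval : ∀ i, ∃ r : ℝ, ∀ ε > 0, C ε + (X i - C r) ∈ Q ∧ C ε - (X i - C r) ∈ Q := by
    intro i
    set T : Set ℝ := {r | X i - C r ∈ Q}
    obtain ⟨N, hN⟩ := hX i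
    have hlow : -(N + 4⁻¹) ∈ T := by
      have := hQ.exists_bound_of_sq (a := -X i) (N := N) (by rw [neg_sq]; exact hN)
      rw [sub_neg_eq_add] at this
      change X i - C (-(N + 4⁻¹)) ∈ Q
      rw [C_neg, sub_neg_eq_add, add_comm]
      exact this
    have hbdd : BddAbove T := by
      refine ⟨N + 4⁻¹, fun r hr => ?_⟩
      have := hQ.add_mem (hQ.exists_bound_of_sq hN) hr
      rw [MvPolynomial.algebraMap_eq, sub_add_sub_cancel, ← C_sub] at this
      linarith [hpos this]
    refine ⟨sSup T, fun ε hε => ⟨?_, ?_⟩⟩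
    · obtain ⟨t, ht, hlt⟩ := exists_lt_of_lt_csSup ⟨_, hlow⟩ (sub_lt_self (sSup T) hε)
      have e : (C ε + (X i - C (sSup T)) : MvPolynomial σ ℝ) =
          C (ε - sSup T + t) + (X i - C t) := by rw [C_add, C_sub]; ring
      rw [e]
      exact hQ.add_mem (hC (by linarith)) ht
    · have hnot : X i - C (sSup T + ε) ∉ Q := fun h => by
        have := le_csSup hbdd (show sSup T + ε ∈ T from h)
        linarith
      have := (mem_or_neg_mem hmax _).resolve_left hnot
      have e : (C ε - (X i - C (sSup T)) : MvPolynomial σ ℝ) = -(X i - C (sSup T + ε)) := by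
        rw [C_add]; ring
      rwa [e]
  choose x hx using hval
  have hbdd := hQ.exists_bound hX
  let J : Ideal (MvPolynomial σ ℝ) :=
    { carrier := {a | ∀ ε > 0, C ε + a ∈ Q ∧ C ε - a ∈ Q}
      zero_mem' := fun ε hε => by simpa using hC hε.le
      add_mem' := by
        intro a b ha hb ε hε
        have e : (C ε : MvPolynomial σ ℝ) = C (ε / 2) + C (ε / 2) := by rw [← C_add, add_halves]
        rw [e, add_add_add_comm, add_sub_add_comm]
        exact ⟨hQ.add_mem (ha _ (half_pos hε)).1 (hb _ (half_pos hε)).1,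
          hQ.add_mem (ha _ (half_pos hε)).2 (hb _ (half_pos hε)).2⟩
      smul_mem' := by
        intro b a ha
        have hsq : ∀ c, ∀ ε > 0, C ε + c ^ 2 * a ∈ Q ∧ C ε - c ^ 2 * a ∈ Q := by
          intro c ε hε
          obtain ⟨N, hN, h⟩ := hbdd c
          set δ := ε / (N + 1) with hδ
          have hδ0 : 0 < δ := by positivity
          have hNδ : N * δ ≤ ε := by
            rw [hδ, mul_div_assoc', div_le_iff₀ (by positivity)]
            nlinarith
          have hc : C ε - c ^ 2 * C δ ∈ Q := by
            have e : C ε - c ^ 2 * C δ = C (ε - N * δ) + C δ * (C N - c ^ 2) := by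
              rw [C_sub, C_mul]; ring
            rw [e, ← smul_eq_C_mul]
            exact hQ.add_mem (hC (by linarith)) (hQ.smul_mem hδ0.le h)
          constructor
          · have e : C ε + c ^ 2 * a = (C ε - c ^ 2 * C δ) + c ^ 2 * (C δ + a) := by ring
            rw [e]
            exact hQ.add_mem hc (hQ.sq_mul_mem c (ha δ hδ0).1)
          · have e : C ε - c ^ 2 * a = (C ε - c ^ 2 * C δ) + c ^ 2 * (C δ - a) := by ring
            rw [e]
            exact hQ.add_mem hc (hQ.sq_mul_mem c (ha δ hδ0).2)
        intro ε hε
        have h2 : (C 2⁻¹ * 2 : MvPolynomial σ ℝ) = 1 := by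
          rw [← map_ofNat C 2, ← C_mul]; norm_num
        have hb : b • a = (C 2⁻¹ * (b + 1)) ^ 2 * a - (C 2⁻¹ * (b - 1)) ^ 2 * a := by
          rw [smul_eq_mul]
          linear_combination (-(C 2⁻¹ * 2 + 1) * b * a) * h2
        have e : (C ε : MvPolynomial σ ℝ) = C (ε / 2) + C (ε / 2) := by rw [← C_add, add_halves]
        obtain ⟨h₁, h₂⟩ := hsq (C 2⁻¹ * (b + 1)) _ (half_pos hε)
        obtain ⟨h₃, h₄⟩ := hsq (C 2⁻¹ * (b - 1)) _ (half_pos hε)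
        refine ⟨?_, ?_⟩
        · convert hQ.add_mem h₁ h₄ using 1
          rw [hb, e]; ring
        · convert hQ.add_mem h₂ h₃ using 1
          rw [hb, e]; ring }
  have hJ : ∀ p : MvPolynomial σ ℝ, p - C (eval x p) ∈ J := by
    intro p
    induction p using MvPolynomial.induction_on with
    | C r => simp
    | add p q hp hq =>
      rw [map_add, C_add, add_sub_add_comm]
      exact J.add_mem hp hq
    | mul_X p i hp =>
      have e : p * X i - C (eval x (p * X i)) =
          p * (X i - C (x i)) + C (x i) * (p - C (eval x p)) := by
        rw [map_mul, eval_X, C_mul]; ring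
      rw [e]
      exact J.add_mem (J.mul_mem_left _ (hx i)) (J.mul_mem_left _ hp)
  obtain ⟨p, hp, hneg⟩ := hpt x
  have h := hQ.add_mem (hMQ hp) (hJ p (-eval x p / 2) (by linarith)).2
  have e : p + (C (-eval x p / 2) - (p - C (eval x p))) = C (eval x p / 2) := by
    rw [show eval x p / 2 = -eval x p / 2 + eval x p by ring, C_add]; ring
  rw [e] at h
  linarith [hpos h]

end IsQuadraticModule

section SOS

variable {σ : Type*}

theorem isSOS_iff_isSumSq {p : MvPolynomial σ ℝ} : IsSOS p ↔ IsSumSq p := by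
  constructor
  · rintro ⟨k, q, rfl⟩
    exact IsSumSq.sum fun i _ => (IsSquare.sq (q i)).isSumSq
  · intro h
    induction h with
    | zero => exact ⟨0, Fin.elim0, by simp⟩
    | sq_add a _ ih =>
      obtain ⟨k, q, rfl⟩ := ih
      exact ⟨k + 1, Fin.cons a q, by simp [Fin.sum_univ_succ, pow_two]⟩

theorem IsSOS.eval_nonneg {p : MvPolynomial σ ℝ} (hp : IsSOS p) (x : σ → ℝ) : 0 ≤ eval x p := by
  obtain ⟨k, q, rfl⟩ := hp
  simp only [map_sum, map_pow]
  positivity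

end SOS

section TruncCone

variable {σ ι κ : Type*} [Fintype ι] [Fintype κ]

/-- The truncated cone `Q_k(g) + I_k(h)`. -/
def truncCone (k : ℕ) (g : ι → MvPolynomial σ ℝ) (h : κ → MvPolynomial σ ℝ) :
    Set (MvPolynomial σ ℝ) :=
  {p | ∃ q1 q2, InTruncQM k g q1 ∧ InTruncId k h q2 ∧ p = q1 + q2}

variable {k : ℕ} {g : ι → MvPolynomial σ ℝ} {h : κ → MvPolynomial σ ℝ}

theorem mem_truncCone_iff {p : MvPolynomial σ ℝ} :
    p ∈ truncCone k g h ↔ ∃ (s0 : MvPolynomial σ ℝ) (s : ι → MvPolynomial σ ℝ)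
      (ps : κ → MvPolynomial σ ℝ), IsSumSq s0 ∧ (∀ j, IsSumSq (s j)) ∧
      s0.totalDegree ≤ 2 * k ∧ (∀ j, (s j * g j).totalDegree ≤ 2 * k) ∧
      (∀ t, (ps t * h t).totalDegree ≤ 2 * k) ∧
      p = s0 + ∑ j, s j * g j + ∑ t, ps t * h t := by
  simp only [← isSOS_iff_isSumSq]
  constructor
  · rintro ⟨_, _, ⟨s0, s, h0, hs, d0, ds, rfl⟩, ⟨ps, dp, rfl⟩, rfl⟩
    exact ⟨s0, s, ps, h0, hs, d0, ds, dp, rfl⟩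
  · rintro ⟨s0, s, ps, h0, hs, d0, ds, dp, rfl⟩
    exact ⟨_, _, ⟨s0, s, h0, hs, d0, ds, rfl⟩, ⟨ps, dp, rfl⟩, rfl⟩

theorem truncCone_mono {l : ℕ} (hkl : k ≤ l) : truncCone k g h ⊆ truncCone l g h := by
  intro p
  simp only [mem_truncCone_iff]
  rintro ⟨s0, s, ps, h0, hs, d0, ds, dp, rfl⟩
  exact ⟨s0, s, ps, h0, hs, by lia, fun j => (ds j).trans (by lia),
    fun t => (dp t).trans (by lia), rfl⟩

theorem add_mem_truncCone {p q : MvPolynomial σ ℝ} (hp : p ∈ truncCone k g h)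
    (hq : q ∈ truncCone k g h) : p + q ∈ truncCone k g h := by
  rw [mem_truncCone_iff] at *
  obtain ⟨s0, s, ps, h0, hs, d0, ds, dp, rfl⟩ := hp
  obtain ⟨s0', s', ps', h0', hs', d0', ds', dp', rfl⟩ := hq
  refine ⟨s0 + s0', s + s', ps + ps', h0.add h0', fun j => (hs j).add (hs' j),
    (totalDegree_add _ _).trans (max_le d0 d0'), fun j => ?_, fun t => ?_, ?_⟩
  · rw [Pi.add_apply, add_mul]
    exact (totalDegree_add _ _).trans (max_le (ds j) (ds' j))
  · rw [Pi.add_apply, add_mul]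
    exact (totalDegree_add _ _).trans (max_le (dp t) (dp' t))
  · simp only [Pi.add_apply, add_mul, Finset.sum_add_distrib]
    ring

theorem isSumSq_C {r : ℝ} (hr : 0 ≤ r) : IsSumSq (C r : MvPolynomial σ ℝ) :=
  IsSquare.isSumSq ⟨C √r, by rw [← C_mul, Real.mul_self_sqrt hr]⟩

theorem C_mul_mem_truncCone {p : MvPolynomial σ ℝ} {r : ℝ} (hr : 0 ≤ r)
    (hp : p ∈ truncCone k g h) : C r * p ∈ truncCone k g h := by
  have hd : ∀ (q : MvPolynomial σ ℝ), q.totalDegree ≤ 2 * k → (C r * q).totalDegree ≤ 2 * k :=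
    fun q hq => (totalDegree_mul _ _).trans (by simpa using hq)
  rw [mem_truncCone_iff] at *
  obtain ⟨s0, s, ps, h0, hs, d0, ds, dp, rfl⟩ := hp
  refine ⟨C r * s0, fun j => C r * s j, fun t => C r * ps t, (isSumSq_C hr).mul h0,
    fun j => (isSumSq_C hr).mul (hs j), hd _ d0, fun j => ?_, fun t => ?_, ?_⟩
  · rw [mul_assoc]; exact hd _ (ds j)
  · rw [mul_assoc]; exact hd _ (dp t)
  · simp only [mul_add, Finset.mul_sum, mul_assoc]

theorem zero_mem_truncCone : (0 : MvPolynomial σ ℝ) ∈ truncCone k g h :=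
  mem_truncCone_iff.2 ⟨0, 0, 0, .zero, fun _ => .zero, by simp, by simp, by simp, by simp⟩

theorem sq_mem_truncCone {q : MvPolynomial σ ℝ} (hq : q.totalDegree ≤ k) :
    q ^ 2 ∈ truncCone k g h :=
  mem_truncCone_iff.2 ⟨q ^ 2, 0, 0, (IsSquare.sq q).isSumSq, fun _ => .zero,
    (totalDegree_pow _ _).trans (by lia), by simp, by simp, by simp⟩

theorem sum_mem_truncCone {α : Type*} (s : Finset α) {p : α → MvPolynomial σ ℝ}
    (hp : ∀ i ∈ s, p i ∈ truncCone k g h) : ∑ i ∈ s, p i ∈ truncCone k g h := by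
  classical
  induction s using Finset.induction_on with
  | empty => simpa using zero_mem_truncCone
  | insert i s hi ih =>
    rw [Finset.sum_insert hi]
    exact add_mem_truncCone (hp _ (by simp)) (ih fun j hj => hp j (by simp [hj]))

theorem mem_iUnion_truncCone_iff {p : MvPolynomial σ ℝ} :
    p ∈ ⋃ k, truncCone k g h ↔ ∃ (s0 : MvPolynomial σ ℝ) (s : ι → MvPolynomial σ ℝ)
      (ps : κ → MvPolynomial σ ℝ), IsSumSq s0 ∧ (∀ j, IsSumSq (s j)) ∧
      p = s0 + ∑ j, s j * g j + ∑ t, ps t * h t := by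
  simp only [Set.mem_iUnion, mem_truncCone_iff]
  constructor
  · rintro ⟨k, s0, s, ps, h0, hs, -, -, -, rfl⟩
    exact ⟨s0, s, ps, h0, hs, rfl⟩
  · rintro ⟨s0, s, ps, h0, hs, rfl⟩
    have h1 := fun j => Finset.le_sup (f := fun j => (s j * g j).totalDegree) (Finset.mem_univ j)
    have h2 := fun t => Finset.le_sup (f := fun t => (ps t * h t).totalDegree) (Finset.mem_univ t)
    refine ⟨s0.totalDegree + Finset.univ.sup (fun j => (s j * g j).totalDegree) +
      Finset.univ.sup (fun t => (ps t * h t).totalDegree), s0, s, ps, h0, hs, by lia,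
      fun j => (h1 j).trans (by lia), fun t => (h2 t).trans (by lia), rfl⟩

theorem isQuadraticModule_iUnion_truncCone : IsQuadraticModule (⋃ k, truncCone k g h) where
  one_mem := mem_iUnion_truncCone_iff.2 ⟨1, 0, 0, .one, fun _ => .zero, by simp⟩
  add_mem := by
    simp only [Set.mem_iUnion]
    rintro a b ⟨k, hk⟩ ⟨l, hl⟩
    exact ⟨max k l, add_mem_truncCone (truncCone_mono (le_max_left _ _) hk)
      (truncCone_mono (le_max_right _ _) hl)⟩
  sq_mul_mem := by
    simp only [mem_iUnion_truncCone_iff]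
    rintro c a ⟨s0, s, ps, h0, hs, rfl⟩
    have hc := (IsSquare.sq c).isSumSq
    exact ⟨c ^ 2 * s0, fun j => c ^ 2 * s j, fun t => c ^ 2 * ps t, hc.mul h0,
      fun j => hc.mul (hs j), by simp only [mul_add, Finset.mul_sum, mul_assoc]⟩

theorem constraint_mem_iUnion_truncCone (j : ι) : g j ∈ ⋃ k, truncCone k g h := by
  classical
  refine mem_iUnion_truncCone_iff.2 ⟨0, Pi.single j 1, 0, .zero, fun i => ?_, ?_⟩
  · by_cases hij : i = j
    · subst hij; simp
    · simp [hij]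
  · simp [Pi.single_apply]

theorem exists_forall_C_mul_mem_truncCone {p : MvPolynomial σ ℝ}
    (hp : p ∈ Ideal.span (Set.range h)) : ∃ k, ∀ r : ℝ, C r * p ∈ truncCone k g h := by
  obtain ⟨ps, rfl⟩ := Ideal.mem_span_range_iff_exists_fun.1 hp
  have h2 := fun t => Finset.le_sup (f := fun t => (ps t * h t).totalDegree) (Finset.mem_univ t)
  refine ⟨Finset.univ.sup (fun t => (ps t * h t).totalDegree), fun r => mem_truncCone_iff.2
    ⟨0, 0, fun t => C r * ps t, .zero, fun _ => .zero, by simp, by simp, fun t => ?_, ?_⟩⟩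
  · rw [mul_assoc]
    refine (totalDegree_mul _ _).trans ?_
    simpa using (h2 t).trans (by lia)
  · simp [Finset.mul_sum, mul_assoc]

theorem mem_iUnion_truncCone_of_mem_span {p : MvPolynomial σ ℝ}
    (hp : p ∈ Ideal.span (Set.range h)) : p ∈ ⋃ k, truncCone k g h := by
  obtain ⟨k, hk⟩ := exists_forall_C_mul_mem_truncCone (g := g) hp
  exact Set.mem_iUnion.2 ⟨k, by simpa using hk 1⟩

theorem rho_eq_sSup_truncCone (f : MvPolynomial σ ℝ) :
    rho k f g h = sSup {ξ : ℝ | f - C ξ ∈ truncCone k g h} := rfl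

end TruncCone

theorem MvPolynomial.totalDegree_aeval_le {σ : Type*} (F : MvPolynomial σ ℝ) (p : Polynomial ℝ) :
    (Polynomial.aeval F p).totalDegree ≤ p.natDegree * F.totalDegree := by
  rw [Polynomial.aeval_eq_sum_range]
  refine totalDegree_finsetSum_le fun i hi => ?_
  refine (totalDegree_smul_le _ _).trans ((totalDegree_pow _ _).trans ?_)
  exact Nat.mul_le_mul_right _ (by simpa [Nat.lt_succ_iff] using hi)

theorem Polynomial.exists_mul_eq_of_root_lt {p : Polynomial ℝ} (hp : p ≠ 0) {a t : ℝ}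
    (ha : p.eval a = 0) (hat : a < t) : ∃ p1 p2 : Polynomial ℝ, p = p1 * p2 ∧
      (∀ x, p1.eval x = 0 → x < t) ∧ (∀ x, p2.eval x = 0 → t ≤ x) ∧ 0 < p1.natDegree := by
  classical
  obtain ⟨q, hq, -, hq0⟩ := Polynomial.exists_prod_multiset_X_sub_C_mul p
  have hmem : ∀ (s : Multiset ℝ) (x : ℝ),
      (s.map fun b => Polynomial.X - Polynomial.C b).prod.eval x = 0 → x ∈ s := by
    intro s x hx
    rw [Polynomial.eval_multiset_prod, Multiset.prod_eq_zero_iff] at hx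
    simp only [Multiset.mem_map, exists_exists_and_eq_and, Polynomial.eval_sub, Polynomial.eval_X,
      Polynomial.eval_C, sub_eq_zero] at hx
    obtain ⟨b, hb, rfl⟩ := hx
    exact hb
  refine ⟨((p.roots.filter (· < t)).map fun b => Polynomial.X - Polynomial.C b).prod,
    ((p.roots.filter (¬ · < t)).map fun b => Polynomial.X - Polynomial.C b).prod * q,
    ?_, fun x hx => ?_, fun x hx => ?_, ?_⟩
  · rw [← mul_assoc, ← Multiset.prod_add, ← Multiset.map_add, Multiset.filter_add_not, hq]
  · exact (Multiset.mem_filter.1 (hmem _ _ hx)).2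
  · rw [Polynomial.eval_mul, mul_eq_zero] at hx
    rcases hx with hx | hx
    · exact not_lt.1 (Multiset.mem_filter.1 (hmem _ _ hx)).2
    · have hqne : q ≠ 0 := by
        rintro rfl
        exact hp (by rw [← hq, mul_zero])
      have : x ∈ q.roots := (Polynomial.mem_roots hqne).2 hx
      simp [hq0] at this
  · rw [Polynomial.natDegree_multiset_prod_X_sub_C_eq_card, Multiset.card_pos_iff_exists_mem]
    exact ⟨a, Multiset.mem_filter.2 ⟨(Polynomial.mem_roots hp).2 ha, hat⟩⟩

theorem Finset.exists_lt_forall_lt {s : Finset ℝ} {t : ℝ} (hs : ∀ x ∈ s, x < t) :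
    ∃ c < t, ∀ x ∈ s, x < c := by
  have h : ∀ᶠ c in nhdsWithin t (Set.Iio t), ∀ x ∈ s, x < c :=
    (Filter.eventually_all_finset s).2 fun x hx =>
      eventually_nhdsWithin_of_eventually_nhds (eventually_gt_nhds (hs x hx))
  obtain ⟨c, hc, hct⟩ := (h.and self_mem_nhdsWithin).exists
  exact ⟨c, hct, hc⟩

/-- If the roots of `p1` are less than `c`, then `p2 ^ 2 * (c - X)` is a sum of squares up to a
multiple of `(p1 * p2) ^ 2`. -/
theorem Polynomial.exists_sq_mul_eq_sum_sq_sub {p1 p2 : Polynomial ℝ} (h1 : 0 < p1.natDegree)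
    {c : ℝ} (hc : ∀ x, p1.eval x = 0 → x < c) :
    ∃ (k : ℕ) (r : Fin k → Polynomial ℝ) (N : ℝ),
      p2 ^ 2 * (Polynomial.C c - Polynomial.X) =
        ∑ i, r i ^ 2 - Polynomial.C N * (p1 * p2) ^ 2 := by
  have hp1 : p1 ≠ 0 := by rintro rfl; simp at h1
  have hdeg : (Polynomial.C c - Polynomial.X).degree < (p1 ^ 2).degree := by
    have hn : (Polynomial.C c - Polynomial.X).natDegree ≤ 1 :=
      (Polynomial.natDegree_sub_le _ _).trans (by simp)
    exact Polynomial.degree_lt_degree (by rw [Polynomial.natDegree_pow]; lia)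
  obtain ⟨N, hN⟩ := Polynomial.exists_forall_eval_add_nonneg hdeg
    (fun x hx => by simpa using hc x hx)
  obtain ⟨k, r, -, hr⟩ := Polynomial.exists_sum_sq_of_nonneg _ _ (Nat.le_mul_of_pos_left _ two_pos) hN
  refine ⟨k, fun i => p2 * r i, N, ?_⟩
  simp only [mul_pow, ← Finset.mul_sum, ← hr]
  ring

/-- If the roots of `p1` are less than `t` and those of `p2` are at least `t`, then
`X - t + ε + K * p2 ^ 2` is a sum of squares of bounded degree up to a multiple of
`(p1 * p2) ^ 2`, where `K` does not depend on `ε`. -/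
theorem Polynomial.exists_forall_sub_eq_sum_sq {p1 p2 : Polynomial ℝ} (h1 : 0 < p1.natDegree)
    (hp2 : p2 ≠ 0) {t : ℝ} (hr1 : ∀ x, p1.eval x = 0 → x < t)
    (hr2 : ∀ x, p2.eval x = 0 → t ≤ x) :
    ∃ K : ℝ, 0 ≤ K ∧ ∀ ε > 0, ∃ (k : ℕ) (a : Fin k → Polynomial ℝ) (N : ℝ),
      (∀ i, (a i).natDegree ≤ (p1 * p2).natDegree) ∧
      Polynomial.X - Polynomial.C (t - ε) =
        ∑ i, a i ^ 2 + Polynomial.C N * (p1 * p2) ^ 2 - Polynomial.C K * p2 ^ 2 := by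
  have hp1 : p1 ≠ 0 := by rintro rfl; simp at h1
  have hK : ∀ᶠ K : ℝ in Filter.atTop, ∀ x ∈ p1.roots.toFinset, 0 < x - t + K * p2.eval x ^ 2 := by
    refine (Filter.eventually_all_finset _).2 fun x hx => ?_
    have hx1 : p1.eval x = 0 := by simpa [hp1] using hx
    have hx2 : 0 < p2.eval x ^ 2 := by
      have : p2.eval x ≠ 0 := fun h => (hr1 x hx1).not_ge (hr2 x h)
      positivity
    filter_upwards [Filter.eventually_gt_atTop ((t - x) / p2.eval x ^ 2)] with K hK
    rw [div_lt_iff₀ hx2] at hK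
    linarith
  obtain ⟨K, hK, hK0⟩ := (hK.and (Filter.eventually_ge_atTop 0)).exists
  refine ⟨K, hK0, fun ε hε => ?_⟩
  set q : Polynomial ℝ := Polynomial.X - Polynomial.C (t - ε) + Polynomial.C K * p2 ^ 2
  have hdeg : q.degree < ((p1 * p2) ^ 2).degree := by
    have hn : q.natDegree ≤ max 1 (2 * p2.natDegree) := by
      refine (Polynomial.natDegree_add_le _ _).trans (max_le_max ?_ ?_)
      · exact (Polynomial.natDegree_X_sub_C _).le
      · exact (Polynomial.natDegree_C_mul_le _ _).trans (by rw [Polynomial.natDegree_pow])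
    refine Polynomial.degree_lt_degree ?_
    rw [Polynomial.natDegree_pow, Polynomial.natDegree_mul hp1 hp2]
    lia
  obtain ⟨N, hN⟩ := Polynomial.exists_forall_eval_add_nonneg hdeg (fun x hx => by
    rw [Polynomial.eval_mul, mul_eq_zero] at hx
    simp only [q, Polynomial.eval_add, Polynomial.eval_sub, Polynomial.eval_X, Polynomial.eval_C,
      Polynomial.eval_mul, Polynomial.eval_pow]
    rcases hx with hx | hx
    · have := hK x (by simpa [hp1] using hx)
      linarith
    · have := hr2 x hx
      rw [hx]
      linarith)
  have hd : (q + Polynomial.C N * (p1 * p2) ^ 2).natDegree ≤ 2 * (p1 * p2).natDegree := by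
    rw [← Polynomial.natDegree_pow]
    refine (Polynomial.natDegree_add_le _ _).trans (max_le ?_ (Polynomial.natDegree_C_mul_le _ _))
    exact Polynomial.natDegree_le_natDegree hdeg.le
  obtain ⟨k, a, ha, hsum⟩ := Polynomial.exists_sum_sq_of_nonneg _ _ hd hN
  refine ⟨k, a, -N, ha, ?_⟩
  rw [← hsum, Polynomial.C_neg]
  simp only [q]
  ring

/-- The constraints `g` generate an archimedean quadratic module. -/
def IsArchimedean {n m : ℕ} (g : Fin m → MvPolynomial (Fin n) ℝ) : Prop :=
  ∀ M : Set (MvPolynomial (Fin n) ℝ), IsQuadraticModule M → (∀ j, g j ∈ M) →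
    ∀ i, ∃ N : ℝ, C N - X i ^ 2 ∈ M

theorem IsSumSq.map_ringHom {A B : Type*} [CommRing A] [CommRing B] (φ : A →+* B) {s : A}
    (hs : IsSumSq s) : IsSumSq (φ s) := by
  induction hs with
  | zero => simp
  | sq_add a _ ih => simpa using ih.sq_add (φ a)

/-- If `f ≥ t` on `S(g)`, then `f - t + ε` has a certificate of order independent of `ε > 0`. -/
theorem exists_forall_sub_mem_truncCone {n m : ℕ} {g : Fin m → MvPolynomial (Fin n) ℝ}
    (hg : Nonsingular g) (harch : IsArchimedean g) (f : MvPolynomial (Fin n) ℝ) {t : ℝ}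
    (ht : ∀ x ∈ Sg g, t ≤ eval x f) :
    ∃ k, ∀ ε > 0, rename Sum.inl f - C (t - ε) ∈
      truncCone k (fun j => rename Sum.inl (g j)) (hFJ f g) := by
  obtain ⟨p0, hp0, hp0mem⟩ := exists_aeval_mem_span_hFJ hg f
  obtain ⟨p1, p2, hp, hr1, hr2, h1⟩ := Polynomial.exists_mul_eq_of_root_lt
    (p := (Polynomial.X - Polynomial.C (t - 1)) * p0)
    (mul_ne_zero (Polynomial.X_sub_C_ne_zero _) hp0) (a := t - 1) (t := t) (by simp) (by simp)
  have hp12 : p1 * p2 ≠ 0 := hp ▸ mul_ne_zero (Polynomial.X_sub_C_ne_zero _) hp0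
  set F : MvPolynomial (Fin n ⊕ Fin (m + 1)) ℝ := rename Sum.inl f
  set G : Fin m → MvPolynomial (Fin n ⊕ Fin (m + 1)) ℝ := fun j => rename Sum.inl (g j)
  have hmem : Polynomial.aeval F (p1 * p2) ^ 2 ∈ Ideal.span (Set.range (hFJ f g)) := by
    rw [pow_two, ← hp, map_mul (Polynomial.aeval F) _ p0]
    exact Ideal.mul_mem_left _ _ (Ideal.mul_mem_left _ _ hp0mem)
  have hQ := isQuadraticModule_iUnion_truncCone (g := G) (h := hFJ f g)
  obtain ⟨c, hct, hc⟩ := Finset.exists_lt_forall_lt (s := p1.roots.toFinset) (t := t)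
    (fun x hx => hr1 x (Polynomial.isRoot_of_mem_roots (Multiset.mem_toFinset.1 hx)))
  obtain ⟨kr, r, N, hr⟩ := Polynomial.exists_sq_mul_eq_sum_sq_sub (p2 := p2) h1 (c := c)
    (fun x hx => hc x (by simpa [left_ne_zero_of_mul hp12] using hx))
  have hM : IsQuadraticModule {q : MvPolynomial (Fin n) ℝ |
      rename Sum.inl q ∈ ⋃ k, truncCone k G (hFJ f g)} := by
    refine ⟨by simpa using hQ.one_mem, fun ha hb => ?_, fun c a ha => ?_⟩
    · simpa only [Set.mem_ofPred_eq, map_add] using hQ.add_mem ha hb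
    · simpa only [Set.mem_ofPred_eq, map_mul, map_pow] using hQ.sq_mul_mem _ ha
  have hgM := fun j => constraint_mem_iUnion_truncCone (g := G) (h := hFJ f g) j
  have hadj : ∀ {M : Set (MvPolynomial (Fin n) ℝ)} {a q}, q ∈ M →
      q ∈ {b | ∃ m ∈ M, ∃ s, IsSumSq s ∧ b = m + s * a} :=
    fun {M a q} hq => ⟨q, hq, 0, .zero, by simp⟩
  obtain ⟨b, hb, s, hs, hbs⟩ := (hM.adjoin (C c - f)).neg_one_mem
    (harch _ (hM.adjoin _) fun j => hadj (hgM j)) (fun x => by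
      by_cases hx : x ∈ Sg g
      · refine ⟨C c - f, ⟨0, hM.zero_mem, 1, .one, by simp⟩, ?_⟩
        have := ht x hx
        simp only [map_sub, eval_C]
        linarith
      · simp only [Sg, Set.mem_ofPred_eq, not_forall, not_le] at hx
        obtain ⟨j, hj⟩ := hx
        exact ⟨g j, hadj (hgM j), hj⟩)
  have hτ : -Polynomial.aeval F p2 ^ 2 ∈ ⋃ k, truncCone k G (hFJ f g) := by
    have e1 := congrArg (Polynomial.aeval F) hr
    have e2 := congrArg (rename (R := ℝ) (Sum.inl : Fin n → Fin n ⊕ Fin (m + 1))) hbs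
    simp only [map_mul, map_pow, map_sub, map_sum, map_add, map_neg, map_one, Polynomial.aeval_C,
      Polynomial.aeval_X, rename_C, algebraMap_eq] at e1 e2
    have e : -Polynomial.aeval F p2 ^ 2 = Polynomial.aeval F p2 ^ 2 * rename Sum.inl b +
        rename Sum.inl s * (∑ i, Polynomial.aeval F (r i) ^ 2) +
        (-(rename Sum.inl s * C N)) * Polynomial.aeval F (p1 * p2) ^ 2 := by
      rw [map_mul]
      linear_combination Polynomial.aeval F p2 ^ 2 * e2 + rename Sum.inl s * e1
    rw [e]
    refine hQ.add_mem (hQ.add_mem (hQ.sq_mul_mem _ hb) ?_)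
      (mem_iUnion_truncCone_of_mem_span (Ideal.mul_mem_left _ _ hmem))
    exact hQ.sumSq_mul_mem (hs.map_ringHom (rename Sum.inl : _ →ₐ[ℝ] _).toRingHom)
      (hQ.sum_mem _ fun i _ => hQ.sq_mem _)
  obtain ⟨k1, hk1⟩ := Set.mem_iUnion.1 hτ
  obtain ⟨k2, hk2⟩ := exists_forall_C_mul_mem_truncCone (g := G) hmem
  obtain ⟨K, hK, hcert⟩ := Polynomial.exists_forall_sub_eq_sum_sq h1 (right_ne_zero_of_mul hp12)
    hr1 hr2
  set k3 := (p1 * p2).natDegree * F.totalDegree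
  refine ⟨k1 + k2 + k3, fun ε hε => ?_⟩
  obtain ⟨ka, a, N', hdeg, ha⟩ := hcert ε hε
  have e := congrArg (Polynomial.aeval F) ha
  simp only [map_mul, map_pow, map_sub, map_sum, map_add, Polynomial.aeval_C, Polynomial.aeval_X,
    algebraMap_eq] at e
  have e' : F - C (t - ε) = ∑ i, Polynomial.aeval F (a i) ^ 2 +
      C N' * Polynomial.aeval F (p1 * p2) ^ 2 + C K * (-Polynomial.aeval F p2 ^ 2) := by
    rw [map_mul, map_sub]
    linear_combination e
  rw [e']
  refine add_mem_truncCone (add_mem_truncCone (sum_mem_truncCone _ fun i _ => ?_)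
    (truncCone_mono (by lia) (hk2 N'))) (truncCone_mono (by lia) (C_mul_mem_truncCone hK hk1))
  refine sq_mem_truncCone ((totalDegree_aeval_le F (a i)).trans ?_)
  exact (Nat.mul_le_mul_right _ (hdeg i)).trans (by lia)

section FritzJohn

variable {n m : ℕ}

theorem MvPolynomial.hasStrictFDerivAt_eval (p : MvPolynomial (Fin n) ℝ) (u : Fin n → ℝ) :
    HasStrictFDerivAt (fun x => eval x p)
      (∑ i, eval u (pderiv i p) • ContinuousLinearMap.proj (R := ℝ) (φ := fun _ : Fin n => ℝ) i)
      u := by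
  induction p using MvPolynomial.induction_on with
  | C a => simpa using hasStrictFDerivAt_const a u
  | add p q hp hq =>
    simp only [map_add, add_smul, Finset.sum_add_distrib]
    exact hp.add hq
  | mul_X p i hp =>
    have h := hp.mul (hasStrictFDerivAt_apply (𝕜 := ℝ) i u)
    simp only [map_mul, eval_X]
    refine h.congr_fderiv ?_
    ext v
    simp [pderiv_X, Pi.single_apply, add_mul, Finset.sum_add_distrib, Finset.mul_sum]
    simp [mul_comm, mul_left_comm, apply_ite (eval u), Finset.sum_ite_eq]

/-- A Fritz John point of the minimization of `f` over `S(g)`, normalised and without the sign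
conditions on the multipliers. -/
theorem exists_eval_hFJ_eq_zero {g : Fin m → MvPolynomial (Fin n) ℝ}
    (f : MvPolynomial (Fin n) ℝ) {u : Fin n → ℝ} (hu : u ∈ Sg g)
    (hmin : ∀ x ∈ Sg g, eval u f ≤ eval x f) :
    ∃ l : Fin (m + 1) → ℝ, ∀ t, eval (Sum.elim u l) (hFJ f g t) = 0 := by
  classical
  have hextr : IsLocalExtrOn (fun x => eval x f)
      {x | ∀ j : {j // eval u (g j) = 0}, eval x (g j) = eval u (g j)} u := by
    left
    have hpos : ∀ᶠ x in nhds u, ∀ j, eval u (g j) ≠ 0 → 0 < eval x (g j) := by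
      refine Filter.eventually_all.2 fun j => ?_
      by_cases hj : eval u (g j) = 0
      · simp [hj]
      · have hc : Continuous fun x => eval x (g j) := MvPolynomial.continuous_eval _
        filter_upwards [hc.continuousAt.eventually_const_lt ((hu j).lt_of_ne' hj)] with x hx _
        exact hx
    refine eventually_nhdsWithin_iff.2 ?_
    filter_upwards [hpos] with x hx hmem
    refine hmin x fun j => ?_
    by_cases hj : eval u (g j) = 0
    · exact ((hmem ⟨j, hj⟩).trans hj).ge
    · exact (hx j hj).le
  obtain ⟨Λ, Λ₀, hne, hsum⟩ := hextr.exists_multipliers_of_hasStrictFDerivAt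
    (fun j => hasStrictFDerivAt_eval (g j) u) (hasStrictFDerivAt_eval f u)
  set μ : Fin (m + 1) → ℝ := Fin.cons Λ₀ fun j => if h : eval u (g j) = 0 then -Λ ⟨j, h⟩ else 0
  have hsub : ∀ a : Fin m → ℝ, ∑ j, μ j.succ * a j = -∑ j : {j // eval u (g j) = 0}, Λ j * a j := by
    intro a
    rw [← Fintype.sum_subtype_add_sum_subtype (fun j => eval u (g j) = 0),
      Finset.sum_eq_zero (s := (Finset.univ : Finset {j // ¬ eval u (g j) = 0}))
        fun j _ => by simp [μ, j.2], add_zero, ← Finset.sum_neg_distrib]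
    exact Finset.sum_congr rfl fun j _ => by simp [μ, j.2]
  have hS : 0 < ∑ j, μ j ^ 2 := by
    refine lt_of_le_of_ne (Finset.sum_nonneg fun j _ => sq_nonneg _) fun h0 => hne ?_
    have hz : ∀ j, μ j = 0 := fun j =>
      pow_eq_zero_iff two_ne_zero |>.1
        ((Finset.sum_eq_zero_iff_of_nonneg fun j _ => sq_nonneg _).1 h0.symm j (Finset.mem_univ j))
    refine Prod.ext (funext fun j => ?_) (hz 0)
    simpa [μ, j.2] using hz j.1.succ
  set S := ∑ j, μ j ^ 2
  refine ⟨fun j => (√S)⁻¹ * μ j, ?_⟩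
  rintro (i | j | _)
  · have h := DFunLike.congr_fun hsum (Pi.single i 1)
    simp [Pi.single_apply] at h
    have h' := hsub fun j => eval u (pderiv i (g j))
    simp only [hFJ, map_sub, map_mul, map_sum, eval_X, eval_rename, Sum.elim_comp_inl,
      Sum.elim_inr, mul_assoc, ← Finset.mul_sum, h']
    simp only [μ, Fin.cons_zero]
    linear_combination (√S)⁻¹ * h
  · simp only [hFJ, map_mul, eval_X, eval_rename, Sum.elim_comp_inl, Sum.elim_inr]
    by_cases hj : eval u (g j) = 0
    · rw [hj, mul_zero]
    · simp [μ, hj]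
  · simp only [hFJ, map_sub, map_one, map_sum, map_pow, eval_X, Sum.elim_inr, mul_pow,
      ← Finset.mul_sum, inv_pow, Real.sq_sqrt hS.le]
    exact sub_eq_zero.2 (inv_mul_cancel₀ hS.ne').symm

theorem eval_nonneg_of_mem_truncCone {σ ι κ : Type*} [Fintype ι] [Fintype κ] {k : ℕ}
    {g : ι → MvPolynomial σ ℝ} {h : κ → MvPolynomial σ ℝ} {p : MvPolynomial σ ℝ}
    (hp : p ∈ truncCone k g h) {x : σ → ℝ} (hg : ∀ j, 0 ≤ eval x (g j))
    (hh : ∀ t, eval x (h t) = 0) : 0 ≤ eval x p := by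
  obtain ⟨_, _, ⟨s0, s, h0, hs, -, -, rfl⟩, ⟨ps, -, rfl⟩, rfl⟩ := hp
  simp only [map_add, map_sum, map_mul, hh, mul_zero, Finset.sum_const_zero, add_zero]
  exact add_nonneg (h0.eval_nonneg x)
    (Finset.sum_nonneg fun j _ => mul_nonneg ((hs j).eval_nonneg x) (hg j))

theorem exists_rho_eq {g : Fin m → MvPolynomial (Fin n) ℝ} (hg : Nonsingular g)
    (harch : IsArchimedean g) (f : MvPolynomial (Fin n) ℝ) {u : Fin n → ℝ} (hu : u ∈ Sg g)
    (hmin : ∀ x ∈ Sg g, eval u f ≤ eval x f) :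
    ∃ k, rho k (rename Sum.inl f) (fun j => rename Sum.inl (g j)) (hFJ f g) = eval u f := by
  obtain ⟨k, hk⟩ := exists_forall_sub_mem_truncCone hg harch f hmin
  obtain ⟨l, hl⟩ := exists_eval_hFJ_eq_zero f hu hmin
  refine ⟨k, ?_⟩
  rw [rho_eq_sSup_truncCone]
  refine csSup_eq_of_forall_le_of_forall_lt_exists_gt ⟨_, hk 1 one_pos⟩ (fun ξ hξ => ?_)
    fun w hw => ⟨eval u f - (eval u f - w) / 2, hk _ (by linarith), by linarith⟩
  have := eval_nonneg_of_mem_truncCone hξ (x := Sum.elim u l)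
    (fun j => by simpa [eval_rename] using hu j) hl
  simpa [eval_rename] using this

end FritzJohn

theorem nonsingular_ballG (n : ℕ) : Nonsingular (ballG n) := by
  intro K _ _ x l h1 h2 j
  have : CharZero K := charZero_of_injective_algebraMap (algebraMap ℝ K).injective
  have e1 : ∀ i, l 0 * x i = 0 := by
    intro i
    have h := h1 i
    simp [ballG, pderiv_X, Pi.single_apply] at h
    simpa using h
  have e0 : ∀ i, l 0 * x i ^ 2 = 0 := fun i => by linear_combination x i * e1 i
  have e2 := h2 0
  simp only [ballG, map_sub, map_sum, map_pow, aeval_X, map_one, mul_sub, mul_one, Finset.mul_sum,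
    e0, Finset.sum_const_zero, sub_zero] at e2
  rwa [Subsingleton.elim j 0]

theorem nonsingular_boxG (n : ℕ) : Nonsingular (boxG n) := by
  intro K _ _ x l h1 h2 j
  have : CharZero K := charZero_of_injective_algebraMap (algebraMap ℝ K).injective
  have e1 : l j * x j = 0 := by
    have h := h1 j
    simp [boxG, pderiv_X, Pi.single_apply, apply_ite (aeval x)] at h
    simpa using h
  have e2 := h2 j
  simp only [boxG, map_sub, map_pow, aeval_X, map_one] at e2
  linear_combination e2 + x j * e1

theorem simplexG_castSucc (n : ℕ) (i : Fin n) : simplexG n i.castSucc = X i :=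
  Fin.snoc_castSucc (α := fun _ => MvPolynomial (Fin n) ℝ) _ _ _

theorem simplexG_last (n : ℕ) : simplexG n (Fin.last n) = C 1 - ∑ i : Fin n, X i :=
  Fin.snoc_last (α := fun _ => MvPolynomial (Fin n) ℝ) _ _

theorem nonsingular_simplexG (n : ℕ) : Nonsingular (simplexG n) := by
  intro K _ _ x l h1 h2
  have e1 : ∀ i : Fin n, l i.castSucc = l (Fin.last n) := by
    intro i
    have h := h1 i
    simp [Fin.sum_univ_castSucc, simplexG_castSucc, simplexG_last, pderiv_X, Pi.single_apply] at h
    linear_combination h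
  have e2 : ∀ i : Fin n, l (Fin.last n) * x i = 0 := by
    intro i
    simpa only [simplexG_castSucc, aeval_X, e1] using h2 i.castSucc
  have e3 := h2 (Fin.last n)
  simp only [simplexG_last, map_sub, map_sum, aeval_X, map_one, mul_sub, mul_one, Finset.mul_sum,
    e2, Finset.sum_const_zero, sub_zero] at e3
  intro j
  cases j using Fin.lastCases with
  | last => exact e3
  | cast i => rw [e1, e3]

theorem isArchimedean_ballG (n : ℕ) : IsArchimedean (ballG n) := by
  intro M hM hg i
  refine ⟨1, ?_⟩
  have e : (C 1 - X i ^ 2 : MvPolynomial (Fin n) ℝ) =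
      ballG n 0 + ∑ j ∈ Finset.univ.erase i, X j ^ 2 := by
    rw [ballG, ← Finset.add_sum_erase _ _ (Finset.mem_univ i)]
    ring
  rw [e]
  exact hM.add_mem (hg 0) (hM.sum_mem _ fun j _ => hM.sq_mem _)

theorem isArchimedean_boxG (n : ℕ) : IsArchimedean (boxG n) :=
  fun _ _ hg i => ⟨1, hg i⟩

theorem isArchimedean_simplexG (n : ℕ) : IsArchimedean (simplexG n) := by
  intro M hM hg i
  have hX : ∀ j : Fin n, X j ∈ M := fun j => simplexG_castSucc n j ▸ hg j.castSucc
  have h1 : (1 - X i : MvPolynomial (Fin n) ℝ) ∈ M := by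
    have e : (1 - X i : MvPolynomial (Fin n) ℝ) =
        simplexG n (Fin.last n) + ∑ j ∈ Finset.univ.erase i, X j := by
      rw [simplexG_last, ← Finset.add_sum_erase _ _ (Finset.mem_univ i), map_one]
      ring
    rw [e]
    exact hM.add_mem (hg _) (hM.sum_mem _ fun j _ => hX j)
  have h2 : (1 + X i : MvPolynomial (Fin n) ℝ) ∈ M := hM.add_mem hM.one_mem (hX i)
  refine ⟨1, ?_⟩
  have e : (C 1 - X i ^ 2 : MvPolynomial (Fin n) ℝ) =
      (1 / 2 : ℝ) • ((1 + X i) ^ 2 * (1 - X i) + (1 - X i) ^ 2 * (1 + X i)) := by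
    have e2 : (1 + X i) ^ 2 * (1 - X i) + (1 - X i) ^ 2 * (1 + X i) =
        (2 : ℝ) • (C 1 - X i ^ 2 : MvPolynomial (Fin n) ℝ) := by
      rw [two_smul, map_one]
      ring
    rw [e2, smul_smul]
    norm_num
  rw [e]
  exact hM.smul_mem (by norm_num)
    (hM.add_mem (hM.sq_mul_mem _ h1) (hM.sq_mul_mem _ h2))

/-- For the unit ball, the unit hypercube and the unit simplex, whenever `f` attains a
global minimizer `u` on `S(g)` (so `f* = f(u)`), the SOS relaxation strengthened with the
Fritz John system is exact: `ρ_k(f, g, h_FJ) = f*` for some `k`. -/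
theorem exact_pop_ball_box_simplex :
    (∀ (n : ℕ) (f : MvPolynomial (Fin n) ℝ) (u : Fin n → ℝ),
      u ∈ Sg (ballG n) → (∀ x ∈ Sg (ballG n), eval u f ≤ eval x f) →
      ∃ k : ℕ, rho k (rename Sum.inl f) (fun j => rename Sum.inl (ballG n j))
        (hFJ f (ballG n)) = eval u f) ∧
    (∀ (n : ℕ) (f : MvPolynomial (Fin n) ℝ) (u : Fin n → ℝ),
      u ∈ Sg (boxG n) → (∀ x ∈ Sg (boxG n), eval u f ≤ eval x f) →
      ∃ k : ℕ, rho k (rename Sum.inl f) (fun j => rename Sum.inl (boxG n j))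
        (hFJ f (boxG n)) = eval u f) ∧
    (∀ (n : ℕ) (f : MvPolynomial (Fin n) ℝ) (u : Fin n → ℝ),
      u ∈ Sg (simplexG n) → (∀ x ∈ Sg (simplexG n), eval u f ≤ eval x f) →
      ∃ k : ℕ, rho k (rename Sum.inl f) (fun j => rename Sum.inl (simplexG n j))
        (hFJ f (simplexG n)) = eval u f) := by
  exact ⟨fun n f _ => exists_rho_eq (nonsingular_ballG n) (isArchimedean_ballG n) f,
    fun n f _ => exists_rho_eq (nonsingular_boxG n) (isArchimedean_boxG n) f,
    fun n f _ => exists_rho_eq (nonsingular_simplexG n) (isArchimedean_simplexG n) f⟩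
end
end

section
/- Let f, g_1, …, g_m ∈ ℝ[x] with g = (g_1,…,g_m). Assume that f is non-negative on S(g) and that the image f(C(g) ∩ S(g)) := {f(x) : x ∈ C(g) ∩ S(g)} is a finite set. Then there exists q ∈ P(g)[x, λ̄] such that f − q vanishes on (S(g) × ℝ^{m+1}) ∩ V(h_FJ). Moreover, if S(g) satisfies the Archimedean condition, one can take q ∈ Q(g)[x, λ̄]. -/
open MvPolynomial

noncomputable section

/-- Membership in the quadratic module `Q(g)` generated by the tuple `g`. -/
def InQM {σ ι : Type*} [Fintype ι] (g : ι → MvPolynomial σ ℝ) (p : MvPolynomial σ ℝ) : Prop :=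
  ∃ (s0 : MvPolynomial σ ℝ) (s : ι → MvPolynomial σ ℝ),
    IsSOS s0 ∧ (∀ j, IsSOS (s j)) ∧ p = s0 + ∑ j, s j * g j

/-- Membership in the preordering `P(g)` generated by the tuple `g`. -/
def InPre {σ ι : Type*} [Fintype ι] [DecidableEq ι] (g : ι → MvPolynomial σ ℝ)
    (p : MvPolynomial σ ℝ) : Prop :=
  ∃ s : Finset ι → MvPolynomial σ ℝ, (∀ A, IsSOS (s A)) ∧
    p = ∑ A : Finset ι, s A * ∏ j ∈ A, g j

/-- `S(g)` satisfies the Archimedean condition. -/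
def ArchCond {n m : ℕ} (g : Fin m → MvPolynomial (Fin n) ℝ) : Prop :=
  ∃ R : ℝ, 0 < R ∧ InQM g (C R - ∑ i : Fin n, X i ^ 2)

/-- The set of critical points `C(g)`. -/
def Cset {n m : ℕ} (g : Fin m → MvPolynomial (Fin n) ℝ) : Set (Fin n → ℝ) :=
  {x | ∃ lam : Fin m → ℝ, lam ≠ 0 ∧
    (∀ i, ∑ j, lam j * eval x (pderiv i (g j)) = 0) ∧
    (∀ j, lam j * eval x (g j) = 0)}

/-- The real variety `V(h_FJ)` of the Fritz John system attached to `f` and `g`. -/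
def VFJ {n m : ℕ} (f : MvPolynomial (Fin n) ℝ) (g : Fin m → MvPolynomial (Fin n) ℝ) :
    Set ((Fin n → ℝ) × (Fin (m + 1) → ℝ)) :=
  {p | (∀ i, p.2 0 * eval p.1 (pderiv i f) = ∑ j, p.2 j.succ * eval p.1 (pderiv i (g j)))
    ∧ (∀ j, p.2 j.succ * eval p.1 (g j) = 0)
    ∧ (∑ j, p.2 j ^ 2 = 1)}

open KaehlerDifferential

section KaehlerField

variable {F K : Type*} [Field F] [CharZero F] [Field K] [Algebra F K]

/-- Over a field of characteristic zero, an element of a field extension whose Kähler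
differential vanishes is algebraic. -/
theorem isAlgebraic_of_kaehlerDifferential_D_eq_zero {a : K}
    (h : KaehlerDifferential.D F K a = 0) : IsAlgebraic F a := by
  by_contra ha
  have hind : AlgebraicIndepOn F id ({a} : Set K) :=
    (algebraicIndependent_singleton_iff (⟨a, rfl⟩ : ({a} : Set K))).mpr ha
  obtain ⟨t, hat, ht⟩ := exists_isTranscendenceBasis_superset hind
  let P := MvPolynomial t F
  let φ : P →ₐ[F] K := MvPolynomial.aeval ((↑) : t → K)
  have hφ : Function.Injective φ := algebraicIndependent_iff_injective_aeval.1 ht.1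
  let : Algebra P K := φ.toRingHom.toAlgebra
  have : IsScalarTower F P K := IsScalarTower.of_algHom φ
  have : FaithfulSMul P K := (faithfulSMul_iff_algebraMap_injective P K).mpr hφ
  have : Algebra.IsAlgebraic (Algebra.adjoin F (Set.range ((↑) : t → K))) K :=
    ht.isAlgebraic
  have : Algebra.IsAlgebraic P K :=
    Algebra.IsAlgebraic.of_ringHom_of_comp_eq (S := Algebra.adjoin F (Set.range ((↑) : t → K)))
      (B := K) ht.1.aevalEquiv (RingHom.id K) ht.1.aevalEquiv.surjective
      Function.injective_id (RingHom.ext fun _ => rfl)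
  let := FractionRing.liftAlgebra P K
  have : Algebra.IsAlgebraic (FractionRing P) K :=
    (IsFractionRing.comap_isAlgebraic_iff (A := P)).mp inferInstance
  have : CharZero (FractionRing P) :=
    charZero_of_injective_algebraMap (IsFractionRing.injective P (FractionRing P))
  have : Algebra.FormallyEtale (FractionRing P) K := .of_isSeparable _ _
  have : Algebra.FormallyEtale P (FractionRing P) :=
    .of_isLocalization (nonZeroDivisors P)
  have : Algebra.FormallyEtale P K := .comp P (FractionRing P) K
  let a' : t := ⟨a, hat rfl⟩
  have ha' : algebraMap P K (X a') = a := aeval_X _ _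
  have hD := tensorKaehlerEquivOfFormallyEtale_symm_D_algebraMap F P K (X a')
  rw [ha', h, map_zero, ← mvPolynomialBasis_apply,
    ← Module.Basis.baseChange_apply] at hD
  exact ((mvPolynomialBasis F t).baseChange K).ne_zero a' hD.symm

theorem MvPolynomial.derivation_aeval {R A M σ : Type*} [CommRing R] [CommRing A] [Algebra R A]
    [AddCommGroup M] [Module A M] [Module R M] [IsScalarTower R A M] [Fintype σ]
    (d : Derivation R A M) (a : σ → A) (p : MvPolynomial σ R) :
    d (aeval a p) = ∑ i, aeval a (pderiv i p) • d (a i) := by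
  classical
  induction p using MvPolynomial.induction_on with
  | C r => simp
  | add p q hp hq => simp [hp, hq, add_smul, Finset.sum_add_distrib]
  | mul_X p j hp =>
    simp [hp, pderiv_X, Pi.single_apply, add_smul, Finset.sum_add_distrib, Finset.smul_sum,
      smul_smul, apply_ite (aeval a), ite_smul]

/-- The value of a polynomial at a point with Lagrange multipliers over an extension field is
algebraic over the base field. -/
theorem isAlgebraic_aeval_of_multipliers {σ ι : Type*} [Fintype σ] [Fintype ι]
    (f : MvPolynomial σ F) (g : ι → MvPolynomial σ F) (a : σ → K) (l₀ : K) (l : ι → K)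
    (hl₀ : l₀ ≠ 0)
    (hgrad : ∀ i, l₀ * aeval a (pderiv i f) = ∑ j, l j * aeval a (pderiv i (g j)))
    (hcompl : ∀ j, l j * aeval a (g j) = 0) : IsAlgebraic F (aeval a f) := by
  apply isAlgebraic_of_kaehlerDifferential_D_eq_zero
  have hg : ∀ j, l j • KaehlerDifferential.D F K (aeval a (g j)) = 0 := fun j => by
    rcases mul_eq_zero.mp (hcompl j) with h | h <;> simp [h]
  have key : l₀ • KaehlerDifferential.D F K (aeval a f) = 0 := by
    calc l₀ • KaehlerDifferential.D F K (aeval a f)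
        = ∑ i, (l₀ * aeval a (pderiv i f)) • KaehlerDifferential.D F K (a i) := by
          rw [derivation_aeval, Finset.smul_sum]; simp only [smul_smul]
      _ = ∑ j, l j • KaehlerDifferential.D F K (aeval a (g j)) := by
          simp only [hgrad, derivation_aeval, Finset.smul_sum, Finset.sum_smul, smul_smul]
          exact Finset.sum_comm
      _ = 0 := Finset.sum_eq_zero fun j _ => hg j
  exact (smul_eq_zero.mp key).resolve_left hl₀

end KaehlerField

/-- The values of a polynomial at points with Lagrange multipliers are roots of one nonzero
univariate polynomial. -/
theorem exists_polynomial_ne_zero_of_multipliers {σ ι : Type*} [Fintype σ] [Fintype ι]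
    (f : MvPolynomial σ ℝ) (g : ι → MvPolynomial σ ℝ) :
    ∃ p : Polynomial ℝ, p ≠ 0 ∧ ∀ (x : σ → ℝ) (l₀ : ℝ) (l : ι → ℝ), l₀ ≠ 0 →
      (∀ i, l₀ * eval x (pderiv i f) = ∑ j, l j * eval x (pderiv i (g j))) →
      (∀ j, l j * eval x (g j) = 0) → p.eval (eval x f) = 0 := by
  classical
  let R := MvPolynomial (σ ⊕ Option ι) ℝ
  let x₀ : σ → R := fun i => X (Sum.inl i)
  let u₀ : R := X (Sum.inr none)
  let u : ι → R := fun j => X (Sum.inr (some j))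
  let I : Ideal R := Ideal.span
    (Set.range (fun i => u₀ * aeval x₀ (pderiv i f) - ∑ j, u j * aeval x₀ (pderiv i (g j))) ∪
      Set.range (fun j => u j * aeval x₀ (g j)))
  have hprime : ∀ P : I.minimalPrimes, ∃ p : Polynomial ℝ, p ≠ 0 ∧
      u₀ * Polynomial.aeval (aeval x₀ f) p ∈ P.1 := by
    rintro ⟨P, hP⟩
    have : P.IsPrime := hP.1.1
    by_cases hu : u₀ ∈ P
    · exact ⟨1, one_ne_zero, P.mul_mem_right _ hu⟩
    let ψ : R →ₐ[ℝ] P.ResidueField := IsScalarTower.toAlgHom ℝ R P.ResidueField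
    have hψ : ∀ r, ψ r = 0 ↔ r ∈ P := fun r => Ideal.algebraMap_residueField_eq_zero
    have hcomp : ∀ p : MvPolynomial σ ℝ, aeval (fun i => ψ (x₀ i)) p = ψ (aeval x₀ p) :=
      fun p => (comp_aeval_apply x₀ ψ p).symm
    have halg := isAlgebraic_aeval_of_multipliers (K := P.ResidueField) f g (fun i => ψ (x₀ i))
      (ψ u₀) (fun j => ψ (u j)) (fun h => hu ((hψ _).1 h))
      (fun i => by
        have h := (hψ _).2 (hP.1.2 (Ideal.subset_span (Or.inl ⟨i, rfl⟩)))
        simp only [map_sub, map_mul, map_sum] at h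
        simpa only [hcomp] using sub_eq_zero.mp h)
      (fun j => by
        have h := (hψ _).2 (hP.1.2 (Ideal.subset_span (Or.inr ⟨j, rfl⟩)))
        simpa only [hcomp, map_mul] using h)
    obtain ⟨p, hp0, hp⟩ := halg
    refine ⟨p, hp0, P.mul_mem_left _ ((hψ _).1 ?_)⟩
    rw [← Polynomial.aeval_algHom_apply, ← hcomp, hp]
  choose p hp0 hp using hprime
  have : Finite I.minimalPrimes := I.finite_minimalPrimes_of_isNoetherianRing R
  have := Fintype.ofFinite I.minimalPrimes
  refine ⟨∏ P, p P, Finset.prod_ne_zero_iff.2 fun P _ => hp0 P, ?_⟩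
  intro x l₀ l hl₀ hgrad hcompl
  have hrad : u₀ * Polynomial.aeval (aeval x₀ f) (∏ P, p P) ∈ I.radical := by
    rw [← Ideal.sInf_minimalPrimes, Submodule.mem_sInf]
    intro P hP
    rw [map_prod, ← Finset.mul_prod_erase _ _ (Finset.mem_univ (⟨P, hP⟩ : I.minimalPrimes)),
      ← mul_assoc]
    exact Ideal.mul_mem_right _ P (hp ⟨P, hP⟩)
  let v : R →ₐ[ℝ] ℝ := aeval (Sum.elim x fun o => o.elim l₀ l)
  have hv : ∀ q : MvPolynomial σ ℝ, v (aeval x₀ q) = eval x q := fun q => by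
    have hx : (fun i => v (x₀ i)) = x := funext fun i => aeval_X _ _
    rw [comp_aeval_apply x₀ v q, hx, aeval_eq_eval]
  have hv₀ : v u₀ = l₀ := aeval_X _ _
  have hvu : ∀ j, v (u j) = l j := fun j => aeval_X _ _
  have hI : I ≤ RingHom.ker v := by
    refine Ideal.span_le.2 ?_
    rintro _ (⟨i, rfl⟩ | ⟨j, rfl⟩)
    · simp only [SetLike.mem_coe, RingHom.mem_ker, map_sub, map_mul, map_sum, hv, hv₀, hvu, hgrad,
        sub_self]
    · simp only [SetLike.mem_coe, RingHom.mem_ker, map_mul, hv, hvu, hcompl]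
  have h := (RingHom.ker_isPrime v).radical_le_iff.2 hI hrad
  rw [RingHom.mem_ker, map_mul, hv₀, ← Polynomial.aeval_algHom_apply, hv] at h
  exact (mul_eq_zero.mp h).resolve_left hl₀

theorem isSOS_zero {σ : Type*} : IsSOS (0 : MvPolynomial σ ℝ) :=
  ⟨0, Fin.elim0, by simp⟩

theorem isSOS_sq {σ : Type*} (q : MvPolynomial σ ℝ) : IsSOS (q ^ 2) :=
  ⟨1, fun _ => q, by simp⟩

theorem IsSOS.inQM {σ ι : Type*} [Fintype ι] {g : ι → MvPolynomial σ ℝ} {q : MvPolynomial σ ℝ}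
    (hq : IsSOS q) : InQM g q :=
  ⟨q, 0, hq, fun _ => isSOS_zero, by simp⟩

theorem IsSOS.inPre {σ ι : Type*} [Fintype ι] [DecidableEq ι] {g : ι → MvPolynomial σ ℝ}
    {q : MvPolynomial σ ℝ} (hq : IsSOS q) : InPre g q := by
  refine ⟨Pi.single ∅ q, fun A => ?_, ?_⟩
  · by_cases hA : A = ∅
    · subst hA; simpa using hq
    · simpa [hA] using isSOS_zero
  · rw [Finset.sum_eq_single ∅ (fun A _ hA => by simp [hA]) (by simp)]
    simp

/-- The objective takes finitely many values on the feasible Fritz John points. -/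
theorem finite_image_VFJ {n m : ℕ} (f : MvPolynomial (Fin n) ℝ)
    (g : Fin m → MvPolynomial (Fin n) ℝ)
    (hfin : ((fun x => eval x f) '' (Cset g ∩ Sg g)).Finite) :
    ((fun p => eval p.1 f) '' {p | p ∈ VFJ f g ∧ p.1 ∈ Sg g}).Finite := by
  obtain ⟨p, hp0, hp⟩ := exists_polynomial_ne_zero_of_multipliers f g
  refine (hfin.union (p.rootSet_finite ℝ)).subset ?_
  rintro _ ⟨⟨x, l⟩, ⟨⟨hgrad, hcompl, hnorm⟩, hS⟩, rfl⟩
  dsimp only at hgrad hcompl hnorm hS ⊢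
  by_cases hl₀ : l 0 = 0
  · refine Or.inl ⟨x, ⟨⟨fun j => l j.succ, fun h => ?_, fun i => ?_, hcompl⟩, hS⟩, rfl⟩
    · have h' : ∀ j : Fin m, l j.succ = 0 := fun j => congrFun h j
      simp [Fin.sum_univ_succ, hl₀, h'] at hnorm
    · rw [← hgrad i, hl₀, zero_mul]
  · right
    rw [Polynomial.mem_rootSet]
    exact ⟨hp0, by simpa using hp x (l 0) (fun j => l j.succ) hl₀ hgrad hcompl⟩

/-- A polynomial with finitely many values, all nonnegative, on a set agrees there with the
square of a polynomial in it. -/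
theorem exists_sq_aeval_eq {σ : Type*} (f : MvPolynomial σ ℝ) {W : Set (σ → ℝ)}
    (hnn : ∀ w ∈ W, 0 ≤ eval w f) (hfin : ((fun w => eval w f) '' W).Finite) :
    ∃ q : MvPolynomial σ ℝ, ∀ w ∈ W, eval w (f - q ^ 2) = 0 := by
  classical
  let r : Polynomial ℝ := Lagrange.interpolate hfin.toFinset id Real.sqrt
  refine ⟨Polynomial.aeval f r, fun w hw => ?_⟩
  have h1 : eval w (Polynomial.aeval f r) = r.eval (eval w f) := by
    have h := Polynomial.aeval_algHom_apply (aeval w : MvPolynomial σ ℝ →ₐ[ℝ] ℝ) f r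
    simpa [aeval_eq_eval] using h.symm
  have h2 : r.eval (eval w f) = √(eval w f) :=
    Lagrange.eval_interpolate_at_node (v := id) Real.sqrt (Function.injective_id.injOn)
      (hfin.mem_toFinset.2 ⟨w, hw, rfl⟩)
  rw [map_sub, map_pow, h1, h2, Real.sq_sqrt (hnn w hw), sub_self]

/-- If `f` is non-negative on `S(g)` and `f(C(g) ∩ S(g))` is finite, then there is
`q ∈ P(g)[x, λ̄]` such that `f − q` vanishes on `(S(g) × ℝ^{m+1}) ∩ V(h_FJ)`;
under the Archimedean condition one can take `q ∈ Q(g)[x, λ̄]`. -/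
theorem rep_FJ_on_Sg {n m : ℕ} (f : MvPolynomial (Fin n) ℝ)
    (g : Fin m → MvPolynomial (Fin n) ℝ)
    (hf : ∀ x ∈ Sg g, 0 ≤ eval x f)
    (hfin : ((fun x => eval x f) '' (Cset g ∩ Sg g)).Finite) :
    (∃ q : MvPolynomial (Fin n ⊕ Fin (m + 1)) ℝ,
      InPre (fun j => rename Sum.inl (g j)) q ∧
      ∀ p ∈ VFJ f g, p.1 ∈ Sg g → eval (Sum.elim p.1 p.2) (rename Sum.inl f - q) = 0) ∧
    (ArchCond g → ∃ q : MvPolynomial (Fin n ⊕ Fin (m + 1)) ℝ,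
      InQM (fun j => rename Sum.inl (g j)) q ∧
      ∀ p ∈ VFJ f g, p.1 ∈ Sg g → eval (Sum.elim p.1 p.2) (rename Sum.inl f - q) = 0) := by
  obtain ⟨q, hq⟩ := exists_sq_aeval_eq (rename Sum.inl f)
    (W := (fun p : (Fin n → ℝ) × (Fin (m + 1) → ℝ) => Sum.elim p.1 p.2) ''
      {p | p ∈ VFJ f g ∧ p.1 ∈ Sg g})
    (by
      rintro _ ⟨p, hp, rfl⟩
      simpa [eval_rename] using hf p.1 hp.2)
    (by
      rw [Set.image_image]
      simpa [eval_rename] using finite_image_VFJ f g hfin)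
  have hq' : ∀ p ∈ VFJ f g, p.1 ∈ Sg g →
      eval (Sum.elim p.1 p.2) (rename Sum.inl f - q ^ 2) = 0 :=
    fun p hp hS => hq _ ⟨p, ⟨hp, hS⟩, rfl⟩
  exact ⟨⟨q ^ 2, (isSOS_sq q).inPre, hq'⟩, fun _ => ⟨q ^ 2, (isSOS_sq q).inQM, hq'⟩⟩
end
end
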